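/- Let m > 0, σ ∈ 𝒜(m), let a < b be reals, n ≥ 1 an integer, h = (b − a)/n, and let g : [a,b] → ℝ. If ε ≥ 0 is such that |g(s) − g(t)| ≤ ε for all s, t ∈ [a,b] with |s − t| < h, then |S_{n,σ}(g, x) − g(x)| ≤ ε for every x ∈ [a, b]. -/

import Mathlib

/-- `phi σ m x = σ(x+m) - σ(x-m)`. -/
noncomputable def phi (σ : ℝ → ℝ) (m : ℝ) (x : ℝ) : ℝ := σ (x + m) - σ (x - m)

/-- The node `x_k = a + k·h` with `h = (b-a)/n`. -/
noncomputable def node (a b : ℝ) (n : ℕ) (k : ℕ) : ℝ := a + k * ((b - a) / n)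

/-- The Cardaliaguet–Euvrard neural network operator
`S_{n,σ}(g, x) = ∑_{k=0}^{n} φ((2m/h)(x − x_k)) · g(x_k)`. -/
noncomputable def NN (σ : ℝ → ℝ) (m a b : ℝ) (n : ℕ) (g : ℝ → ℝ) (x : ℝ) : ℝ :=
  ∑ k ∈ Finset.range (n + 1),
    phi σ m (2 * m / ((b - a) / n) * (x - node a b n k)) * g (node a b n k)

/-- For a monotone `σ`, the bump `phi σ m` is nonnegative. -/
theorem phi_nonneg {σ : ℝ → ℝ} (hσ : Monotone σ) {m : ℝ} (hm : 0 ≤ m) (y : ℝ) :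
    0 ≤ phi σ m y :=
  sub_nonneg.2 (hσ (by linarith))

/-- If `σ` is `0` left of `-m` and `1` right of `m`, then `phi σ m` vanishes outside
`(-2m, 2m)`. -/
theorem phi_eq_zero_of_two_mul_le_abs {σ : ℝ → ℝ} {m : ℝ} (hm : 0 ≤ m)
    (hσ0 : ∀ x : ℝ, x ≤ -m → σ x = 0) (hσ1 : ∀ x : ℝ, m ≤ x → σ x = 1)
    {y : ℝ} (hy : 2 * m ≤ |y|) : phi σ m y = 0 := by
  unfold phi
  rcases le_abs.1 hy with h | h
  · rw [hσ1 _ (by linarith), hσ1 _ (by linarith), sub_self]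
  · rw [hσ0 _ (by linarith), hσ0 _ (by linarith), sub_self]

/-- The translates of `phi σ m` by multiples of `2m` telescope. -/
theorem sum_range_phi_sub_mul (σ : ℝ → ℝ) (m y : ℝ) (n : ℕ) :
    ∑ k ∈ Finset.range n, phi σ m (y - 2 * m * k) = σ (y + m) - σ (y + m - 2 * m * n) := by
  have h := Finset.sum_range_sub' (fun k : ℕ => σ (y + m - 2 * m * k)) n
  simp only [Nat.cast_zero, mul_zero, sub_zero] at h
  rw [← h]
  refine Finset.sum_congr rfl fun k _ => ?_
  unfold phi
  push_cast
  congr 2 <;> ring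

/-- Nodes with index at most `n` lie in `[a, b]`. -/
theorem node_mem_Icc {a b : ℝ} (hab : a ≤ b) {n k : ℕ} (hn : 1 ≤ n) (hk : k ≤ n) :
    node a b n k ∈ Set.Icc a b := by
  have hn' : (0 : ℝ) < n := by exact_mod_cast hn
  have hk' : (k : ℝ) ≤ n := by exact_mod_cast hk
  have hh : 0 ≤ (b - a) / n := div_nonneg (sub_nonneg.2 hab) hn'.le
  have hmul : (n : ℝ) * ((b - a) / n) = b - a := mul_div_cancel₀ _ hn'.ne'
  have := mul_le_mul_of_nonneg_right hk' hh
  have := mul_nonneg (Nat.cast_nonneg (α := ℝ) k) hh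
  unfold node
  constructor <;> linarith

/-- Jackson-type estimate for real-valued functions: if `|g(s) − g(t)| ≤ ε` whenever
`|s − t| < h = (b − a)/n`, then `|S_{n,σ}(g, x) − g(x)| ≤ ε` for every `x ∈ [a,b]`. -/
theorem stmt4 (m : ℝ) (hm : 0 < m) (σ : ℝ → ℝ)
    (hσ_mono : Monotone σ)
    (hσ0 : ∀ x : ℝ, x ≤ -m → σ x = 0)
    (hσ1 : ∀ x : ℝ, m ≤ x → σ x = 1)
    (a b : ℝ) (hab : a < b) (n : ℕ) (hn : 1 ≤ n) (g : ℝ → ℝ)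
    (ε : ℝ) (hε : 0 ≤ ε)
    (hmod : ∀ s ∈ Set.Icc a b, ∀ t ∈ Set.Icc a b,
      |s - t| < (b - a) / n → |g s - g t| ≤ ε) :
    ∀ x ∈ Set.Icc a b, |NN σ m a b n g x - g x| ≤ ε := by
  intro x hx
  have hn' : (0 : ℝ) < n := by exact_mod_cast hn
  have hmul : (n : ℝ) * ((b - a) / n) = b - a := mul_div_cancel₀ _ hn'.ne'
  have hh : 0 < (b - a) / n := div_pos (sub_pos.2 hab) hn'
  unfold NN
  set h := (b - a) / (n : ℝ) with hdef
  have hc : 0 < 2 * m / h := by positivity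
  have hch : 2 * m / h * h = 2 * m := div_mul_cancel₀ _ hh.ne'
  have hsum : ∑ k ∈ Finset.range (n + 1), phi σ m (2 * m / h * (x - node a b n k)) = 1 := by
    have hshift : ∀ k : ℕ, 2 * m / h * (x - node a b n k)
        = 2 * m / h * (x - a) - 2 * m * k := fun k => by
      unfold node
      rw [← hdef]
      linear_combination -(k : ℝ) * hch
    simp only [hshift]
    rw [sum_range_phi_sub_mul]
    have hy0 : 0 ≤ 2 * m / h * (x - a) := mul_nonneg hc.le (sub_nonneg.2 hx.1)
    have hy1 : 2 * m / h * (x - a) ≤ 2 * m * n := by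
      calc 2 * m / h * (x - a) ≤ 2 * m / h * (n * h) := by
            rw [hmul]
            exact mul_le_mul_of_nonneg_left (by linarith [hx.2]) hc.le
        _ = 2 * m * n := by linear_combination (n : ℝ) * hch
    rw [hσ1 _ (by linarith), hσ0 _ (by push_cast; linarith), sub_zero]
  have hterm : ∀ k ∈ Finset.range (n + 1),
      |phi σ m (2 * m / h * (x - node a b n k)) * (g (node a b n k) - g x)|
        ≤ phi σ m (2 * m / h * (x - node a b n k)) * ε := by
    intro k hk
    have hphi := phi_nonneg hσ_mono hm.le (2 * m / h * (x - node a b n k))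
    rw [abs_mul, abs_of_nonneg hphi]
    rcases lt_or_ge |node a b n k - x| h with hlt | hge
    · exact mul_le_mul_of_nonneg_left
        (hmod _ (node_mem_Icc hab.le hn (Nat.lt_succ_iff.1 (Finset.mem_range.1 hk))) x hx hlt) hphi
    · rw [phi_eq_zero_of_two_mul_le_abs hm.le hσ0 hσ1, zero_mul, zero_mul]
      rw [abs_mul, abs_of_pos hc, abs_sub_comm]
      exact hch.ge.trans (mul_le_mul_of_nonneg_left hge hc.le)
  calc _ = |∑ k ∈ Finset.range (n + 1),
        phi σ m (2 * m / h * (x - node a b n k)) * (g (node a b n k) - g x)| := by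
        simp only [mul_sub, Finset.sum_sub_distrib, ← Finset.sum_mul] at hsum ⊢
        rw [hsum, one_mul]
    _ ≤ ∑ k ∈ Finset.range (n + 1), phi σ m (2 * m / h * (x - node a b n k)) * ε :=
        (Finset.abs_sum_le_sum_abs _ _).trans (Finset.sum_le_sum hterm)
    _ = ε := by rw [← Finset.sum_mul, hsum, one_mul]
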